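/- For every sufficiently small δ > 0 there exist constants β₁ ≥ 1, A > 0 and K such that the following holds: for every even integer k ≥ K, every Hecke-multiplicative λ, and every integer L with β₁ ≤ L < δ √(k/log k) such that |λ(l)| ≥ k^{−δ/2} for all integers 1 ≤ l ≤ L, every zero z of f_k with −1/2 < Re z ≤ 1/2 and Im z ≥ A k/L satisfies Re z = 0 or Re z = 1/2 and is a simple zero; moreover, for each integer l with β₁ ≤ l ≤ L − 1 there is exactly one zero z of f_k with (k−1)/(4π(l+1)) < Im z ≤ (k−1)/(4πl), and this zero has Re z = 1/2 if λ(l)λ(l+1) > 0 and Re z = 0 if λ(l)λ(l+1) < 0. -/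

import Mathlib

/-- `λ : ℕ → ℝ` is Hecke-multiplicative: `λ(1) = 1`, `λ` is multiplicative on coprime
arguments, satisfies the Hecke recursion at prime powers, and Deligne's bound
`|λ(p)| ≤ 2` at primes. -/
def HeckeMult (lam : ℕ → ℝ) : Prop :=
  lam 1 = 1 ∧
  (∀ m n : ℕ, Nat.Coprime m n → lam (m * n) = lam m * lam n) ∧
  (∀ p n : ℕ, p.Prime → 1 ≤ n → lam p * lam (p ^ n) = lam (p ^ (n + 1)) + lam (p ^ (n - 1))) ∧
  (∀ p : ℕ, p.Prime → |lam p| ≤ 2)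

/-- `f_k(z) = Σ_{n≥1} λ(n) n^((k-1)/2) e(nz)`. -/
noncomputable def fk (k : ℕ) (lam : ℕ → ℝ) (z : ℂ) : ℂ :=
  ∑' n : ℕ, (lam (n + 1) : ℂ) * (((n + 1 : ℕ) : ℝ) ^ (((k : ℝ) - 1) / 2) : ℝ) *
    Complex.exp (2 * Real.pi * Complex.I * (n + 1 : ℕ) * z)

theorem HeckeMult.abs_le_sq {lam : ℕ → ℝ} (h : HeckeMult lam) {n : ℕ} (hn : n ≠ 0) :
    |lam n| ≤ (n : ℝ) ^ 2 := by
  obtain ⟨h1, hmul, hrec, hp⟩ := h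
  induction n using Nat.recOnPosPrimePosCoprime with
  | zero => exact absurd rfl hn
  | one => simp [h1]
  | prime_pow p a hpp ha =>
    have hp2 : (2 : ℝ) ≤ p := by exact_mod_cast hpp.two_le
    have key : ∀ a : ℕ, |lam (p ^ a)| ≤ ((p : ℝ) ^ 2) ^ a ∧
        |lam (p ^ (a + 1))| ≤ ((p : ℝ) ^ 2) ^ (a + 1) := by
      intro a
      induction a with
      | zero =>
        refine ⟨by simp [h1], ?_⟩
        have := hp p hpp
        simp only [zero_add, pow_one]
        nlinarith
      | succ a ih =>
        refine ⟨ih.2, ?_⟩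
        have e : lam (p ^ (a + 1 + 1)) = lam p * lam (p ^ (a + 1)) - lam (p ^ a) := by
          have := hrec p (a + 1) hpp (by omega)
          simp only [Nat.add_sub_cancel] at this
          linarith
        have hq : (4 : ℝ) ≤ (p : ℝ) ^ 2 := by nlinarith
        have hqa : 0 ≤ ((p : ℝ) ^ 2) ^ a := by positivity
        have hb : |lam p * lam (p ^ (a + 1))| ≤ 2 * ((p : ℝ) ^ 2) ^ (a + 1) := by
          rw [abs_mul]
          exact mul_le_mul (hp p hpp) ih.2 (abs_nonneg _) (by norm_num)
        calc |lam (p ^ (a + 1 + 1))| ≤ |lam p * lam (p ^ (a + 1))| + |lam (p ^ a)| := by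
              rw [e]; exact abs_sub _ _
          _ ≤ 2 * ((p : ℝ) ^ 2) ^ (a + 1) + ((p : ℝ) ^ 2) ^ a := add_le_add hb ih.1
          _ ≤ ((p : ℝ) ^ 2) ^ (a + 1 + 1) := by
              generalize (p : ℝ) ^ 2 = q at *
              have hX : 0 ≤ q ^ 2 - 2 * q - 1 := by nlinarith
              rw [pow_succ q (a + 1), pow_succ q a]
              nlinarith [mul_nonneg hqa hX]
    have := (key a).1
    rw [← pow_mul, mul_comm 2 a, pow_mul] at this
    exact_mod_cast this
  | coprime a b ha hb hab iha ihb =>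
    rw [hmul a b hab, abs_mul, Nat.cast_mul, mul_pow]
    exact mul_le_mul (iha (by omega)) (ihb (by omega)) (abs_nonneg _) (by positivity)

/-- The coefficient of `e((n + 1) z)` in `fk k lam z`. -/
noncomputable def heckeCoeff (k : ℕ) (lam : ℕ → ℝ) (n : ℕ) : ℝ :=
  lam (n + 1) * ((n + 1 : ℕ) : ℝ) ^ (((k : ℝ) - 1) / 2)

theorem log_div_le_of_one_le_abs_sub {N B : ℝ} (hN : 0 < N) (hB : 1 ≤ B) (hm : 1 ≤ |N - B|) :
    Real.log (N / B) ≤ (N - B) / B - |N - B| / (6 * B ^ 2) := by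
  have hB0 : 0 < B := by linarith
  have hNB : 0 < N / B := by positivity
  set s := √(N / B) with hs
  have hs0 : 0 < s := Real.sqrt_pos.2 hNB
  have hss : s ^ 2 = N / B := Real.sq_sqrt hNB.le
  have hlog : Real.log (N / B) ≤ 2 * (s - 1) := by
    rw [← hss, Real.log_pow]
    have := Real.log_le_sub_one_of_pos hs0
    push_cast
    linarith
  have hfrac : (N - B) / B = s ^ 2 - 1 := by rw [hss]; field_simp
  have hsq : (s - 1) ^ 2 * (s + 1) ^ 2 = |N - B| ^ 2 / B ^ 2 := by
    rw [sq_abs, ← div_pow, hfrac]; ring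
  have hle : (s + 1) ^ 2 ≤ 6 * |N - B| := by
    have h1 : (s + 1) ^ 2 ≤ 2 * s ^ 2 + 2 := by nlinarith [sq_nonneg (s - 1)]
    have h2 : s ^ 2 ≤ 1 + |N - B| := by
      rw [hss, div_le_iff₀ hB0]
      nlinarith [le_abs_self (N - B), mul_nonneg (abs_nonneg (N - B)) (sub_nonneg.2 hB)]
    linarith
  have hfin : |N - B| / (6 * B ^ 2) ≤ (s - 1) ^ 2 := by
    have h3 : |N - B| ^ 2 / B ^ 2 ≤ (s - 1) ^ 2 * (6 * |N - B|) := by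
      rw [← hsq]; exact mul_le_mul_of_nonneg_left hle (sq_nonneg _)
    rw [div_le_iff₀ (by positivity)] at h3 ⊢
    nlinarith
  rw [hfrac]
  linarith

/-- Domination of the `n`-th term by the `j`-th one, with a gain of a large power of `k`. -/
theorem abs_heckeCoeff_mul_exp_le {k : ℕ} {lam : ℕ → ℝ} (hl : HeckeMult lam) (hk : 32 ≤ k)
    {j n : ℕ} (hjn : n ≠ j) (hjk : j + 1 ≤ k)
    (hsize : 60 * ((j : ℝ) + 1) ^ 2 * Real.log k ≤ ((k : ℝ) - 1) / 2)
    (hlow : (k : ℝ)⁻¹ ≤ |lam (j + 1)|) {t : ℝ}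
    (hlt : n < j → t ≤ ((k : ℝ) - 1) / 2 / (j + 1))
    (hgt : j < n → ((k : ℝ) - 1) / 2 / (j + 1) ≤ t) :
    |heckeCoeff k lam n| * Real.exp (-t) ^ (n + 1) * (|(n : ℝ) - j| + 1) ≤
      1 / 16 * (1 / ((n : ℝ) + 1) ^ 2) *
        (|heckeCoeff k lam j| * Real.exp (-t) ^ (j + 1)) := by
  set κ : ℝ := ((k : ℝ) - 1) / 2 with hκ
  set N : ℝ := (n : ℝ) + 1 with hN
  set B : ℝ := (j : ℝ) + 1 with hB
  have hk' : (32 : ℝ) ≤ k := by exact_mod_cast hk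
  have hN1 : 1 ≤ N := by simp [hN]
  have hB1 : 1 ≤ B := by simp [hB]
  have hN0 : 0 < N := by linarith
  have hB0 : 0 < B := by linarith
  have hκ0 : 0 < κ := by rw [hκ]; linarith
  obtain ⟨m, hm⟩ : ∃ m : ℕ, (m : ℝ) = |(n : ℝ) - j| :=
    ⟨((n : ℤ) - j).natAbs, by rw [Nat.cast_natAbs]; push_cast; rfl⟩
  have hmNB : (m : ℝ) = |N - B| := by rw [hm, hN, hB]; congr 1; ring
  have hm1 : 1 ≤ m := by
    rcases Nat.eq_zero_or_pos m with h | h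
    · rw [h, Nat.cast_zero, eq_comm, abs_eq_zero, sub_eq_zero] at hm
      exact absurd (by exact_mod_cast hm) hjn
    · exact h
  have hm1' : (1 : ℝ) ≤ m := by exact_mod_cast hm1
  have hprod : (N - B) * (κ / B) ≤ (N - B) * t := by
    rcases lt_or_gt_of_ne hjn with h | h
    · have : (n : ℝ) < j := by exact_mod_cast h
      exact mul_le_mul_of_nonpos_left (hlt h) (by linarith)
    · have : (j : ℝ) < n := by exact_mod_cast h
      exact mul_le_mul_of_nonneg_left (hgt h) (by linarith)
  have hlog := log_div_le_of_one_le_abs_sub hN0 hB1 (hmNB ▸ hm1')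
  rw [Real.log_div hN0.ne' hB0.ne', ← hmNB] at hlog
  have hgain : 10 * m * Real.log k ≤ κ * (m / (6 * B ^ 2)) := by
    rw [← mul_div_assoc, le_div_iff₀ (by positivity)]
    nlinarith
  have hexp : κ * Real.log N - N * t ≤ κ * Real.log B - B * t - 10 * m * Real.log k := by
    have h1 := mul_le_mul_of_nonneg_left hlog hκ0.le
    have h2 : κ * ((N - B) / B) = (N - B) * (κ / B) := by ring
    nlinarith
  have hpow : N ^ κ * Real.exp (-t) ^ (n + 1) ≤
      B ^ κ * Real.exp (-t) ^ (j + 1) * ((k : ℝ) ^ (10 * m))⁻¹ := by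
    rw [Real.rpow_def_of_pos hN0, Real.rpow_def_of_pos hB0, ← Real.exp_nat_mul,
      ← Real.exp_nat_mul, ← Real.rpow_natCast, Real.rpow_def_of_pos (by linarith : (0 : ℝ) < k),
      ← Real.exp_neg, ← Real.exp_add, ← Real.exp_add, ← Real.exp_add]
    apply Real.exp_le_exp.2
    push_cast
    rw [← hN, ← hB]
    linarith
  have hNk : N ≤ k * ((m : ℝ) + 1) := by
    have h1 : N ≤ B + m := by rw [hmNB]; linarith [le_abs_self (N - B)]
    have h2 : B ≤ k := by rw [hB]; exact_mod_cast hjk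
    nlinarith
  have hm2 : (m : ℝ) + 1 ≤ 2 ^ m := by exact_mod_cast Nat.lt_two_pow_self
  have hpoly : N ^ 2 * (m + 1) * (16 * N ^ 2) * k ≤ (k : ℝ) ^ (10 * m) := by
    have h4 : N ^ 4 ≤ (k * ((m : ℝ) + 1)) ^ 4 := pow_le_pow_left₀ hN0.le hNk 4
    have h5 : ((m : ℝ) + 1) ^ 5 ≤ k ^ m := by
      calc ((m : ℝ) + 1) ^ 5 ≤ (2 ^ m) ^ 5 := pow_le_pow_left₀ (by positivity) hm2 5
        _ = (32 : ℝ) ^ m := by rw [← pow_mul, mul_comm, pow_mul]; norm_num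
        _ ≤ k ^ m := pow_le_pow_left₀ (by norm_num) hk' m
    calc N ^ 2 * (m + 1) * (16 * N ^ 2) * k = 16 * k * (m + 1) * N ^ 4 := by ring
      _ ≤ 16 * k * (m + 1) * (k * ((m : ℝ) + 1)) ^ 4 := by gcongr
      _ = 16 * (k : ℝ) ^ 5 * ((m : ℝ) + 1) ^ 5 := by ring
      _ ≤ k * (k : ℝ) ^ 5 * k ^ m := by gcongr; linarith
      _ = (k : ℝ) ^ (6 + m) := by ring
      _ ≤ (k : ℝ) ^ (10 * m) := pow_le_pow_right₀ (by linarith) (by omega)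
  have hlamN : |lam (n + 1)| ≤ N ^ 2 := by
    have := hl.abs_le_sq (n := n + 1) (by omega)
    rwa [Nat.cast_succ] at this
  have hk0 : (0 : ℝ) < k := by linarith
  have hP : (0 : ℝ) < (k : ℝ) ^ (10 * m) := by positivity
  have hcN : |heckeCoeff k lam n| = |lam (n + 1)| * N ^ κ := by
    rw [heckeCoeff, abs_mul, Nat.cast_succ, abs_of_pos (Real.rpow_pos_of_pos hN0 _)]
  have hcB : |heckeCoeff k lam j| = |lam (j + 1)| * B ^ κ := by
    rw [heckeCoeff, abs_mul, Nat.cast_succ, abs_of_pos (Real.rpow_pos_of_pos hB0 _)]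
  rw [hcN, hcB, ← hm]
  set Y : ℝ := B ^ κ * Real.exp (-t) ^ (j + 1) with hY
  have hY0 : 0 < Y := by positivity
  calc |lam (n + 1)| * N ^ κ * Real.exp (-t) ^ (n + 1) * (m + 1)
      = |lam (n + 1)| * (m + 1) * (N ^ κ * Real.exp (-t) ^ (n + 1)) := by ring
    _ ≤ N ^ 2 * (m + 1) * (Y * ((k : ℝ) ^ (10 * m))⁻¹) := by gcongr
    _ ≤ 1 / 16 * (1 / N ^ 2) * ((k : ℝ)⁻¹ * Y) := by
        have : N ^ 2 * (m + 1) * ((k : ℝ) ^ (10 * m))⁻¹ ≤ 1 / 16 * (1 / N ^ 2) * (k : ℝ)⁻¹ := by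
          rw [← div_eq_mul_inv, div_le_iff₀ hP]
          have e : 1 / 16 * (1 / N ^ 2) * (k : ℝ)⁻¹ * (k : ℝ) ^ (10 * m) =
            (k : ℝ) ^ (10 * m) / (16 * N ^ 2 * k) := by field_simp
          rw [e, le_div_iff₀ (by positivity)]
          linarith
        nlinarith
    _ ≤ 1 / 16 * (1 / N ^ 2) * (|lam (j + 1)| * Y) := by gcongr
    _ = _ := by rw [hY]; ring

/-- A series whose terms outside a finite set are small is close to the finite sum. -/
theorem norm_sub_sum_le_of_hasSum {E : Type*} [NormedAddCommGroup E] {g : ℕ → E} {s : E}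
    (hg : HasSum g s) (T : Finset ℕ) {v : ℝ} (hv : 0 ≤ v)
    (h : ∀ n ∉ T, ‖g n‖ ≤ v * (1 / ((n : ℝ) + 1) ^ 2)) : ‖s - ∑ n ∈ T, g n‖ ≤ 2 * v := by
  have hT : HasSum (fun n => if n ∈ T then g n else 0) (∑ n ∈ T, g n) := by
    rw [← Finset.sum_congr rfl fun n hn => if_pos (c := n ∈ T) (t := g n) (e := 0) hn]
    exact hasSum_sum_of_ne_finset_zero fun n hn => if_neg hn
  have hu : HasSum (fun n : ℕ => 1 / ((n : ℝ) + 1) ^ 2) (Real.pi ^ 2 / 6) := by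
    have := (hasSum_nat_add_iff' 1).2 hasSum_zeta_two
    simpa using this
  have hle := (hg.sub hT).norm_le_of_bounded (hu.mul_left v) fun n => by
    by_cases hn : n ∈ T
    · simp only [if_pos hn, sub_self, norm_zero]; positivity
    · simpa only [if_neg hn, sub_zero] using h n hn
  have hpi : Real.pi ^ 2 / 6 ≤ 2 := by nlinarith [Real.pi_lt_d2, Real.pi_pos]
  nlinarith

theorem summable_abs_heckeCoeff_mul_exp {k : ℕ} {lam : ℕ → ℝ} (hl : HeckeMult lam) {t : ℝ}
    (ht : 0 < t) : Summable fun n => |heckeCoeff k lam n| * Real.exp (-t) ^ (n + 1) := by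
  have h := (summable_nat_add_iff 1).2 (Real.summable_pow_mul_exp_neg_nat_mul (2 + k) ht)
  refine h.of_nonneg_of_le (fun n => by positivity) fun n => ?_
  have hN : (1 : ℝ) ≤ ((n + 1 : ℕ) : ℝ) := by simp
  have hpow : ((n + 1 : ℕ) : ℝ) ^ (((k : ℝ) - 1) / 2) ≤ ((n + 1 : ℕ) : ℝ) ^ k := by
    rw [← Real.rpow_natCast]
    exact Real.rpow_le_rpow_of_exponent_le hN (by linarith [(Nat.cast_nonneg k : (0 : ℝ) ≤ k)])
  rw [heckeCoeff, abs_mul, ← Real.exp_nat_mul, pow_add,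
    abs_of_nonneg (Real.rpow_nonneg (by positivity) _), mul_comm (-t)]
  have e : -t * ((n + 1 : ℕ) : ℝ) = ((n + 1 : ℕ) : ℝ) * -t := mul_comm _ _
  gcongr
  exact hl.abs_le_sq (by omega)

theorem norm_exp_two_pi_I_mul (z : ℂ) :
    ‖Complex.exp (2 * Real.pi * Complex.I * z)‖ = Real.exp (-(2 * Real.pi * z.im)) := by
  rw [Complex.norm_exp]
  simp

theorem fk_term_eq (k : ℕ) (lam : ℕ → ℝ) (z : ℂ) (n : ℕ) :
    (lam (n + 1) : ℂ) * (((n + 1 : ℕ) : ℝ) ^ (((k : ℝ) - 1) / 2) : ℝ) *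
      Complex.exp (2 * Real.pi * Complex.I * (n + 1 : ℕ) * z) =
    (heckeCoeff k lam n : ℂ) * Complex.exp (2 * Real.pi * Complex.I * z) ^ (n + 1) := by
  rw [heckeCoeff, ← Complex.exp_nat_mul, Complex.ofReal_mul]
  congr 2
  ring

theorem norm_fk_term (k : ℕ) (lam : ℕ → ℝ) (z : ℂ) (n : ℕ) :
    ‖(heckeCoeff k lam n : ℂ) * Complex.exp (2 * Real.pi * Complex.I * z) ^ (n + 1)‖ =
      |heckeCoeff k lam n| * Real.exp (-(2 * Real.pi * z.im)) ^ (n + 1) := by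
  rw [norm_mul, norm_pow, norm_exp_two_pi_I_mul, Complex.norm_real, Real.norm_eq_abs]

theorem hasSum_fk {k : ℕ} {lam : ℕ → ℝ} (hl : HeckeMult lam) {z : ℂ} (hz : 0 < z.im) :
    HasSum (fun n => (heckeCoeff k lam n : ℂ) *
      Complex.exp (2 * Real.pi * Complex.I * z) ^ (n + 1)) (fk k lam z) := by
  have h : Summable fun n => (heckeCoeff k lam n : ℂ) *
      Complex.exp (2 * Real.pi * Complex.I * z) ^ (n + 1) := by
    refine Summable.of_norm ?_
    simp only [norm_fk_term]
    exact summable_abs_heckeCoeff_mul_exp hl (by positivity)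
  convert h.hasSum using 1
  exact tsum_congr fun n => fk_term_eq k lam z n

theorem hasDerivAt_fk_term (k : ℕ) (lam : ℕ → ℝ) (z : ℂ) (n : ℕ) :
    HasDerivAt (fun z => (heckeCoeff k lam n : ℂ) *
      Complex.exp (2 * Real.pi * Complex.I * z) ^ (n + 1))
      (2 * Real.pi * Complex.I * (((n : ℂ) + 1) * ((heckeCoeff k lam n : ℂ) *
      Complex.exp (2 * Real.pi * Complex.I * z) ^ (n + 1)))) z := by
  have h := ((((hasDerivAt_id z).const_mul (2 * Real.pi * Complex.I)).cexp).pow (n + 1)).const_mul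
    (heckeCoeff k lam n : ℂ)
  refine h.congr_deriv ?_
  simp only [id, Nat.add_sub_cancel]
  push_cast
  ring

theorem fk_term_bound_of_im_ge {k : ℕ} {lam : ℕ → ℝ} {y : ℝ} {z : ℂ} (hz : y < z.im) (n : ℕ) :
    ‖(heckeCoeff k lam n : ℂ) * Complex.exp (2 * Real.pi * Complex.I * z) ^ (n + 1)‖ ≤
      |heckeCoeff k lam n| * Real.exp (-(2 * Real.pi * y)) ^ (n + 1) := by
  rw [norm_fk_term]
  gcongr

theorem fk_eq_tsum (k : ℕ) (lam : ℕ → ℝ) :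
    fk k lam = fun z => ∑' n, (heckeCoeff k lam n : ℂ) *
      Complex.exp (2 * Real.pi * Complex.I * z) ^ (n + 1) :=
  funext fun z => tsum_congr fun n => fk_term_eq k lam z n

theorem isOpen_lt_im (y : ℝ) : IsOpen {z : ℂ | y < z.im} :=
  isOpen_lt continuous_const Complex.continuous_im

theorem continuousAt_fk {k : ℕ} {lam : ℕ → ℝ} (hl : HeckeMult lam) {z : ℂ} (hz : 0 < z.im) :
    ContinuousAt (fk k lam) z := by
  have h := Complex.differentiableOn_tsum_of_summable_norm
    (summable_abs_heckeCoeff_mul_exp (k := k) hl (by positivity : 0 < 2 * Real.pi * (z.im / 2)))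
    (fun n z _ => (hasDerivAt_fk_term k lam z n).differentiableAt.differentiableWithinAt)
    (isOpen_lt_im (z.im / 2)) (fun n w hw => fk_term_bound_of_im_ge hw n)
  rw [← fk_eq_tsum] at h
  exact (h.differentiableAt ((isOpen_lt_im (z.im / 2)).mem_nhds
    (by simpa using hz))).continuousAt

theorem hasSum_deriv_fk {k : ℕ} {lam : ℕ → ℝ} (hl : HeckeMult lam) {z : ℂ} (hz : 0 < z.im) :
    HasSum (fun n : ℕ => 2 * Real.pi * Complex.I * (((n : ℂ) + 1) * ((heckeCoeff k lam n : ℂ) *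
      Complex.exp (2 * Real.pi * Complex.I * z) ^ (n + 1)))) (deriv (fk k lam) z) := by
  have h := Complex.hasSum_deriv_of_summable_norm
    (summable_abs_heckeCoeff_mul_exp (k := k) hl (by positivity : 0 < 2 * Real.pi * (z.im / 2)))
    (fun n z _ => (hasDerivAt_fk_term k lam z n).differentiableAt.differentiableWithinAt)
    (isOpen_lt_im (z.im / 2)) (fun n w hw => fk_term_bound_of_im_ge hw n)
    (show z ∈ {w : ℂ | z.im / 2 < w.im} by simpa using hz)
  rw [← fk_eq_tsum] at h
  simpa only [(hasDerivAt_fk_term k lam z _).deriv] using h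

/-- On the circle of radius `ρ`, the terms of `∑ c n w ^ (n + 1)` below the `j`-th are dominated
by the `j`-th one and the terms above the `(j + 1)`-st by the `(j + 1)`-st one. -/
structure TwoTermDominated (c : ℕ → ℝ) (j : ℕ) (ρ : ℝ) : Prop where
  below : ∀ n < j, |c n| * ρ ^ (n + 1) * ((j : ℝ) - n) ≤
    1 / 16 * (1 / ((n : ℝ) + 1) ^ 2) * (|c j| * ρ ^ (j + 1))
  above : ∀ n, j + 1 < n → |c n| * ρ ^ (n + 1) * ((n : ℝ) - j) ≤
    1 / 16 * (1 / ((n : ℝ) + 1) ^ 2) * (|c (j + 1)| * ρ ^ (j + 2))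

namespace TwoTermDominated

variable {c : ℕ → ℝ} {j : ℕ}

theorem norm_term_le {ρ : ℝ} (hρ : 0 ≤ ρ) (h : TwoTermDominated c j ρ) {n : ℕ}
    (hn : n ∉ ({j, j + 1} : Finset ℕ)) :
    |c n| * ρ ^ (n + 1) * |(n : ℝ) - j| ≤
      1 / 16 * (|c j| * ρ ^ (j + 1) + |c (j + 1)| * ρ ^ (j + 2)) * (1 / ((n : ℝ) + 1) ^ 2) := by
  have h0 : 0 ≤ |c j| * ρ ^ (j + 1) := by positivity
  have h1 : 0 ≤ |c (j + 1)| * ρ ^ (j + 2) := by positivity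
  have hu : 0 ≤ 1 / ((n : ℝ) + 1) ^ 2 := by positivity
  simp only [Finset.mem_insert, Finset.mem_singleton, not_or] at hn
  rcases lt_or_gt_of_ne hn.1 with hlt | hgt
  · have hc : (n : ℝ) < j := by exact_mod_cast hlt
    rw [abs_of_neg (sub_neg.2 hc), neg_sub]
    nlinarith [h.below n hlt, mul_nonneg hu h1]
  · have hc : (j : ℝ) < n := by exact_mod_cast hgt
    rw [abs_of_pos (sub_pos.2 hc)]
    nlinarith [h.above n (by omega), mul_nonneg hu h0]

theorem one_le_abs_sub {n : ℕ} (hn : n ≠ j) : 1 ≤ |(n : ℝ) - j| := by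
  have : (1 : ℤ) ≤ |(n : ℤ) - j| := Int.one_le_abs (sub_ne_zero.2 (by exact_mod_cast hn))
  exact_mod_cast this

theorem le_two_mul_of_hasSum_zero {w : ℂ} (h : TwoTermDominated c j ‖w‖)
    (hs : HasSum (fun n => (c n : ℂ) * w ^ (n + 1)) 0) :
    |c j| * ‖w‖ ^ (j + 1) ≤ 2 * (|c (j + 1)| * ‖w‖ ^ (j + 2)) := by
  have hv : 0 ≤ 1 / 16 * (|c j| * ‖w‖ ^ (j + 1) + |c (j + 1)| * ‖w‖ ^ (j + 2)) := by positivity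
  have key := norm_sub_sum_le_of_hasSum hs {j, j + 1} hv fun n hn => by
    refine le_trans ?_ (h.norm_term_le (norm_nonneg w) hn)
    rw [norm_mul, norm_pow, Complex.norm_real, Real.norm_eq_abs]
    refine le_mul_of_one_le_right (by positivity) (one_le_abs_sub ?_)
    rintro rfl
    simp at hn
  rw [Finset.sum_pair (by omega), zero_sub, norm_neg] at key
  have h2 := norm_sub_le ((c j : ℂ) * w ^ (j + 1) + (c (j + 1) : ℂ) * w ^ (j + 1 + 1))
    ((c (j + 1) : ℂ) * w ^ (j + 1 + 1))
  rw [add_sub_cancel_right] at h2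
  simp only [norm_mul, norm_pow, Complex.norm_real, Real.norm_eq_abs] at h2
  have h1 : 0 ≤ |c (j + 1)| * ‖w‖ ^ (j + 2) := by positivity
  linarith

theorem hasSum_deriv_ne_zero {w s : ℂ} (hw : w ≠ 0) (hc : c (j + 1) ≠ 0)
    (h : TwoTermDominated c j ‖w‖) (hs : HasSum (fun n => (c n : ℂ) * w ^ (n + 1)) 0)
    (hd : HasSum (fun n : ℕ => ((n : ℂ) + 1) * ((c n : ℂ) * w ^ (n + 1))) s) : s ≠ 0 := by
  rintro rfl
  have hle := h.le_two_mul_of_hasSum_zero hs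
  have hv : 0 ≤ 1 / 16 * (|c j| * ‖w‖ ^ (j + 1) + |c (j + 1)| * ‖w‖ ^ (j + 2)) := by positivity
  have hM : 0 < |c (j + 1)| * ‖w‖ ^ (j + 2) :=
    mul_pos (abs_pos.2 hc) (pow_pos (norm_pos_iff.2 hw) _)
  have key := norm_sub_sum_le_of_hasSum (hd.sub (hs.mul_left ((j : ℂ) + 1))) {j, j + 1} hv
    fun n hn => by
      refine le_trans (le_of_eq ?_) (h.norm_term_le (norm_nonneg w) hn)
      rw [← sub_mul, norm_mul, norm_mul, norm_pow, Complex.norm_real, Real.norm_eq_abs,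
        add_sub_add_right_eq_sub, mul_comm]
      congr 1
      rw [← Real.norm_eq_abs, ← Complex.norm_real]
      push_cast
      rfl
  rw [Finset.sum_pair (by omega)] at key
  have e : (0 - ((j : ℂ) + 1) * 0) - ((((j : ℂ) + 1) * ((c j : ℂ) * w ^ (j + 1)) -
      ((j : ℂ) + 1) * ((c j : ℂ) * w ^ (j + 1))) +
      ((((j + 1 : ℕ) : ℂ) + 1) * ((c (j + 1) : ℂ) * w ^ (j + 1 + 1)) -
      ((j : ℂ) + 1) * ((c (j + 1) : ℂ) * w ^ (j + 1 + 1)))) =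
      -((c (j + 1) : ℂ) * w ^ (j + 2)) := by
    push_cast
    ring
  rw [e, norm_neg, norm_mul, norm_pow, Complex.norm_real, Real.norm_eq_abs] at key
  linarith

theorem norm_pow_sub_pow_le {v w : ℂ} (hvw : ‖v‖ ≤ ‖w‖) (m : ℕ) :
    ‖v ^ m - w ^ m‖ ≤ ‖v - w‖ * (m * ‖w‖ ^ (m - 1)) := by
  rw [← Commute.geom_sum₂_mul (Commute.all v w), mul_comm, norm_mul]
  gcongr
  refine (norm_sum_le _ _).trans ?_
  calc ∑ i ∈ Finset.range m, ‖v ^ i * w ^ (m - 1 - i)‖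
      ≤ ∑ i ∈ Finset.range m, ‖w‖ ^ (m - 1) := Finset.sum_le_sum fun i hi => by
        rw [norm_mul, norm_pow, norm_pow]
        calc ‖v‖ ^ i * ‖w‖ ^ (m - 1 - i) ≤ ‖w‖ ^ i * ‖w‖ ^ (m - 1 - i) := by gcongr
          _ = ‖w‖ ^ (m - 1) := by
            rw [← pow_add]; congr 1; have := Finset.mem_range.1 hi; omega
    _ = m * ‖w‖ ^ (m - 1) := by simp

theorem eq_of_hasSum_zero_of_norm_le {v w : ℂ} (hv : v ≠ 0) (hvw : ‖v‖ ≤ ‖w‖)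
    (hc : c (j + 1) ≠ 0) (hdv : TwoTermDominated c j ‖v‖) (hdw : TwoTermDominated c j ‖w‖)
    (hsv : HasSum (fun n => (c n : ℂ) * v ^ (n + 1)) 0)
    (hsw : HasSum (fun n => (c n : ℂ) * w ^ (n + 1)) 0) : v = w := by
  by_contra hne
  have hd : 0 < ‖v - w‖ := norm_pos_iff.2 (sub_ne_zero.2 hne)
  have hr : 0 < ‖v‖ := norm_pos_iff.2 hv
  have hle := hdw.le_two_mul_of_hasSum_zero hsw
  set r := ‖v‖ with hr_def
  set R := ‖w‖ with hR_def
  set D := ‖v - w‖ with hD_def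
  have hR : 0 < R := hr.trans_le hvw
  have hle' : |c j| ≤ 2 * (|c (j + 1)| * R) := by
    have hp : 0 < R ^ (j + 1) := by positivity
    refine le_of_mul_le_mul_right (hle.trans_eq ?_) hp
    ring
  set M := D * (|c (j + 1)| * (r * R) ^ (j + 1)) with hM_def
  have hM : 0 < M := by
    have := abs_pos.2 hc
    positivity
  have key := norm_sub_sum_le_of_hasSum
    ((hsv.mul_right (w ^ (j + 1))).sub (hsw.mul_right (v ^ (j + 1)))) {j, j + 1}
    (by positivity : 0 ≤ 1 / 8 * M) fun n hn => by
      simp only [Finset.mem_insert, Finset.mem_singleton, not_or] at hn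
      rcases lt_or_gt_of_ne hn.1 with hlt | hgt
      · obtain ⟨m, rfl⟩ := Nat.exists_eq_add_of_lt hlt
        have hb := hdv.below n hlt
        have e : (c n : ℂ) * v ^ (n + 1) * w ^ (n + m + 1 + 1) -
            c n * w ^ (n + 1) * v ^ (n + m + 1 + 1) =
            -(c n * (v * w) ^ (n + 1) * (v ^ (m + 1) - w ^ (m + 1))) := by ring
        rw [e, norm_neg, norm_mul, norm_mul, norm_pow, norm_mul, Complex.norm_real,
          Real.norm_eq_abs]
        have hp := norm_pow_sub_pow_le hvw (m + 1)
        rw [Nat.add_sub_cancel] at hp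
        have hj : ((n + m + 1 : ℕ) : ℝ) - n = (m + 1 : ℕ) := by push_cast; ring
        rw [hj] at hb
        calc |c n| * (r * R) ^ (n + 1) * ‖v ^ (m + 1) - w ^ (m + 1)‖
            ≤ |c n| * (r * R) ^ (n + 1) * (D * ((m + 1 : ℕ) * R ^ m)) := by gcongr
          _ = D * R ^ (n + m + 1) * (|c n| * r ^ (n + 1) * (m + 1 : ℕ)) := by ring
          _ ≤ D * R ^ (n + m + 1) * (1 / 16 * (1 / ((n : ℝ) + 1) ^ 2) *
                (|c (n + m + 1)| * r ^ (n + m + 1 + 1))) := by gcongr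
          _ ≤ D * R ^ (n + m + 1) * (1 / 16 * (1 / ((n : ℝ) + 1) ^ 2) *
                (2 * (|c (n + m + 1 + 1)| * R) * r ^ (n + m + 1 + 1))) := by gcongr
          _ = 1 / 8 * M * (1 / ((n : ℝ) + 1) ^ 2) := by rw [hM_def]; ring
      · obtain ⟨m, rfl⟩ := Nat.exists_eq_add_of_lt hgt
        have hb := hdw.above (j + m + 1) (by omega)
        have e : (c (j + m + 1) : ℂ) * v ^ (j + m + 1 + 1) * w ^ (j + 1) -
            c (j + m + 1) * w ^ (j + m + 1 + 1) * v ^ (j + 1) =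
            c (j + m + 1) * (v * w) ^ (j + 1) * (v ^ (m + 1) - w ^ (m + 1)) := by ring
        rw [e, norm_mul, norm_mul, norm_pow, norm_mul, Complex.norm_real, Real.norm_eq_abs]
        have hp := norm_pow_sub_pow_le hvw (m + 1)
        rw [Nat.add_sub_cancel] at hp
        have hj : ((j + m + 1 : ℕ) : ℝ) - j = (m + 1 : ℕ) := by push_cast; ring
        rw [hj] at hb
        have hb' : |c (j + m + 1)| * R ^ (j + m + 1) * (m + 1 : ℕ) ≤
            1 / 16 * (1 / (((j + m + 1 : ℕ) : ℝ) + 1) ^ 2) * (|c (j + 1)| * R ^ (j + 1)) := by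
          refine le_of_mul_le_mul_right (le_trans (le_of_eq ?_) (hb.trans (le_of_eq ?_))) hR
          · ring
          · ring
        calc |c (j + m + 1)| * (r * R) ^ (j + 1) * ‖v ^ (m + 1) - w ^ (m + 1)‖
            ≤ |c (j + m + 1)| * (r * R) ^ (j + 1) * (D * ((m + 1 : ℕ) * R ^ m)) := by gcongr
          _ = D * r ^ (j + 1) * (|c (j + m + 1)| * R ^ (j + m + 1) * (m + 1 : ℕ)) := by ring
          _ ≤ D * r ^ (j + 1) * (1 / 16 * (1 / (((j + m + 1 : ℕ) : ℝ) + 1) ^ 2) *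
                (|c (j + 1)| * R ^ (j + 1))) := by gcongr
          _ = 1 / 16 * M * (1 / (((j + m + 1 : ℕ) : ℝ) + 1) ^ 2) := by rw [hM_def]; ring
          _ ≤ 1 / 8 * M * (1 / (((j + m + 1 : ℕ) : ℝ) + 1) ^ 2) := by gcongr; norm_num
  rw [Finset.sum_pair (by omega)] at key
  have e : (0 * w ^ (j + 1) - 0 * v ^ (j + 1)) -
      (((c j : ℂ) * v ^ (j + 1) * w ^ (j + 1) - c j * w ^ (j + 1) * v ^ (j + 1)) +
      ((c (j + 1) : ℂ) * v ^ (j + 1 + 1) * w ^ (j + 1) -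
        c (j + 1) * w ^ (j + 1 + 1) * v ^ (j + 1))) =
      -((v - w) * (c (j + 1) * (v * w) ^ (j + 1))) := by ring
  rw [e, norm_neg, norm_mul, norm_mul, norm_pow, norm_mul, Complex.norm_real,
    Real.norm_eq_abs] at key
  change M ≤ _ at key
  linarith

theorem eq_of_hasSum_zero {v w : ℂ} (hv : v ≠ 0) (hw : w ≠ 0)
    (hc : c (j + 1) ≠ 0) (hdv : TwoTermDominated c j ‖v‖) (hdw : TwoTermDominated c j ‖w‖)
    (hsv : HasSum (fun n => (c n : ℂ) * v ^ (n + 1)) 0)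
    (hsw : HasSum (fun n => (c n : ℂ) * w ^ (n + 1)) 0) : v = w := by
  rcases le_total ‖v‖ ‖w‖ with h | h
  · exact eq_of_hasSum_zero_of_norm_le hv h hc hdv hdw hsv hsw
  · exact (eq_of_hasSum_zero_of_norm_le hw h hc hdw hdv hsw hsv).symm

end TwoTermDominated

theorem heckeCoeff_ne_zero {k : ℕ} {lam : ℕ → ℝ} {n : ℕ} (h : lam (n + 1) ≠ 0) :
    heckeCoeff k lam n ≠ 0 :=
  mul_ne_zero h (Real.rpow_pos_of_pos (by positivity) _).ne'

theorem twoTermDominated_heckeCoeff {k : ℕ} {lam : ℕ → ℝ} (hl : HeckeMult lam) (hk : 32 ≤ k)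
    {j : ℕ} (hjk : j + 2 ≤ k)
    (hsize : 60 * ((j : ℝ) + 2) ^ 2 * Real.log k ≤ ((k : ℝ) - 1) / 2)
    (hlow : ∀ i ≤ j + 1, (k : ℝ)⁻¹ ≤ |lam (i + 1)|) {t : ℝ}
    (hlt : ((k : ℝ) - 1) / 2 / (j + 2) ≤ t) (hgt : t ≤ ((k : ℝ) - 1) / 2 / (j + 1)) :
    TwoTermDominated (heckeCoeff k lam) j (Real.exp (-t)) := by
  have hk' : (1 : ℝ) ≤ k := by exact_mod_cast (by omega : 1 ≤ k)
  have hlog : 0 ≤ Real.log k := Real.log_nonneg hk'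
  have hsize' : 60 * ((j : ℝ) + 1) ^ 2 * Real.log k ≤ ((k : ℝ) - 1) / 2 := by
    refine le_trans ?_ hsize
    gcongr
    norm_num
  have hj2 : (((j + 1 : ℕ) : ℝ) + 1) = (j : ℝ) + 2 := by push_cast; ring
  constructor
  · intro n hn
    refine le_trans ?_ (abs_heckeCoeff_mul_exp_le hl hk hn.ne (by omega) hsize'
      (hlow j (by omega)) (fun _ => hgt) (fun h => absurd h (by omega)))
    gcongr
    linarith [neg_abs_le ((n : ℝ) - j)]
  · intro n hn
    refine le_trans ?_ (abs_heckeCoeff_mul_exp_le (j := j + 1) hl hk hn.ne' (by omega)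
      (by rw [hj2]; exact hsize) (hlow (j + 1) le_rfl) (fun h => absurd h (by omega))
      (fun _ => by rw [hj2]; exact hlt))
    gcongr
    push_cast
    linarith [le_abs_self ((n : ℝ) - (j + 1))]

theorem norm_fk_sub_term_le {k : ℕ} {lam : ℕ → ℝ} (hl : HeckeMult lam) (hk : 32 ≤ k)
    {j : ℕ} (hjk : j + 1 ≤ k)
    (hsize : 60 * ((j : ℝ) + 1) ^ 2 * Real.log k ≤ ((k : ℝ) - 1) / 2)
    (hlow : (k : ℝ)⁻¹ ≤ |lam (j + 1)|) {z : ℂ} (hz : 0 < z.im)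
    (hlt : 0 < j → 2 * Real.pi * z.im ≤ ((k : ℝ) - 1) / 2 / (j + 1))
    (hgt : ((k : ℝ) - 1) / 2 / (j + 1) ≤ 2 * Real.pi * z.im) :
    ‖fk k lam z - heckeCoeff k lam j * Complex.exp (2 * Real.pi * Complex.I * z) ^ (j + 1)‖ ≤
      1 / 8 * ‖(heckeCoeff k lam j : ℂ) *
        Complex.exp (2 * Real.pi * Complex.I * z) ^ (j + 1)‖ := by
  have key := norm_sub_sum_le_of_hasSum (hasSum_fk (k := k) hl hz) {j}
    (v := 1 / 16 * (|heckeCoeff k lam j| * Real.exp (-(2 * Real.pi * z.im)) ^ (j + 1)))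
    (by positivity) fun n hn => by
      rw [Finset.mem_singleton] at hn
      rw [norm_fk_term]
      refine le_trans ?_ ((abs_heckeCoeff_mul_exp_le hl hk hn hjk hsize hlow
        (fun h => hlt (by omega)) (fun _ => hgt)).trans_eq (by ring))
      exact le_mul_of_one_le_right (by positivity) (by linarith [abs_nonneg ((n : ℝ) - j)])
  rw [Finset.sum_singleton] at key
  rw [norm_fk_term]
  linarith

theorem ne_zero_of_inv_le_abs {k : ℕ} (hk : 0 < k) {x : ℝ} (h : (k : ℝ)⁻¹ ≤ |x|) : x ≠ 0 :=
  abs_pos.1 (lt_of_lt_of_le (by positivity) h)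

theorem fk_ne_zero_of_le_im {k : ℕ} {lam : ℕ → ℝ} (hl : HeckeMult lam) (hk : 32 ≤ k)
    (hsize : 60 * Real.log k ≤ ((k : ℝ) - 1) / 2) {z : ℂ} (hz : 0 < z.im)
    (hgt : ((k : ℝ) - 1) / 2 ≤ 2 * Real.pi * z.im) : fk k lam z ≠ 0 := by
  intro h0
  have hk1 : (1 : ℝ) ≤ k := by exact_mod_cast (by omega : 1 ≤ k)
  have key := norm_fk_sub_term_le (j := 0) hl hk (by omega) (by simpa using hsize)
    (by simpa [hl.1] using inv_le_one_of_one_le₀ hk1) hz (fun h => absurd h (by omega))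
    (by simpa using hgt)
  have hne : (heckeCoeff k lam 0 : ℂ) *
      Complex.exp (2 * Real.pi * Complex.I * z) ^ (0 + 1) ≠ 0 :=
    mul_ne_zero (Complex.ofReal_ne_zero.2 (heckeCoeff_ne_zero (by simp [hl.1])))
      (pow_ne_zero _ (Complex.exp_ne_zero _))
  rw [h0, zero_sub, norm_neg] at key
  linarith [norm_pos_iff.2 hne]

/-- `f_k` takes real values on the lines where `e(z)` is real. -/
theorem fk_im_eq_zero {k : ℕ} {lam : ℕ → ℝ} (hl : HeckeMult lam) {z : ℂ} (hz : 0 < z.im) {v : ℝ}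
    (hv : Complex.exp (2 * Real.pi * Complex.I * z) = v) : (fk k lam z).im = 0 := by
  have h := Complex.hasSum_im (hasSum_fk (k := k) hl hz)
  rw [hv] at h
  refine h.unique ?_
  convert hasSum_zero with n
  rw [← Complex.ofReal_pow, ← Complex.ofReal_mul, Complex.ofReal_im]

theorem mul_fk_re_pos {k : ℕ} {lam : ℕ → ℝ} (hl : HeckeMult lam) (hk : 32 ≤ k)
    {j : ℕ} (hjk : j + 1 ≤ k)
    (hsize : 60 * ((j : ℝ) + 1) ^ 2 * Real.log k ≤ ((k : ℝ) - 1) / 2)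
    (hlow : (k : ℝ)⁻¹ ≤ |lam (j + 1)|) {z : ℂ} (hz : 0 < z.im)
    (hzt : 2 * Real.pi * z.im = ((k : ℝ) - 1) / 2 / (j + 1)) {v : ℝ}
    (hv : Complex.exp (2 * Real.pi * Complex.I * z) = v) :
    0 < lam (j + 1) * v ^ (j + 1) * (fk k lam z).re := by
  have key := norm_fk_sub_term_le hl hk hjk hsize hlow hz (fun _ => hzt.le) hzt.ge
  have hv0 : v ≠ 0 := by
    rintro rfl
    exact Complex.exp_ne_zero _ (hv.trans Complex.ofReal_zero)
  have hpos : 0 < ((j + 1 : ℕ) : ℝ) ^ (((k : ℝ) - 1) / 2) :=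
    Real.rpow_pos_of_pos (by positivity) _
  have hne : heckeCoeff k lam j * v ^ (j + 1) ≠ 0 :=
    mul_ne_zero (heckeCoeff_ne_zero (ne_zero_of_inv_le_abs (by omega) hlow)) (pow_ne_zero _ hv0)
  rw [hv, ← Complex.ofReal_pow, ← Complex.ofReal_mul, Complex.norm_real, Real.norm_eq_abs] at key
  have hre := (Complex.abs_re_le_norm _).trans key
  rw [Complex.sub_re, Complex.ofReal_re] at hre
  have hprod : 0 < heckeCoeff k lam j * v ^ (j + 1) * (fk k lam z).re := by
    generalize heckeCoeff k lam j * v ^ (j + 1) = a at hre hne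
    generalize (fk k lam z).re = b at hre
    obtain ⟨h1, h2⟩ := abs_le.1 hre
    rcases lt_or_gt_of_ne hne with ha | ha
    · rw [abs_of_neg ha] at h1 h2
      exact mul_pos_of_neg_of_neg ha (by linarith)
    · rw [abs_of_pos ha] at h1 h2
      exact mul_pos ha (by linarith)
  refine pos_of_mul_pos_right (b := lam (j + 1) * v ^ (j + 1) * (fk k lam z).re) ?_ hpos.le
  rw [heckeCoeff] at hprod
  linarith

theorem eq_of_exp_eq_of_re_mem {z w : ℂ} (hz : -(1 / 2) < z.re) (hz' : z.re ≤ 1 / 2)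
    (hw : -(1 / 2) < w.re) (hw' : w.re ≤ 1 / 2)
    (h : Complex.exp (2 * Real.pi * Complex.I * z) = Complex.exp (2 * Real.pi * Complex.I * w)) :
    z = w := by
  obtain ⟨n, hn⟩ := Complex.exp_eq_exp_iff_exists_int.1 h
  have hzw : z = w + n := by
    apply mul_left_cancel₀ Complex.two_pi_I_ne_zero
    linear_combination hn
  have hre : z.re = w.re + n := by rw [hzw]; simp
  have h1 : (n : ℝ) < 1 := by linarith
  have h2 : (-1 : ℝ) < n := by linarith
  have h1' : n < 1 := by exact_mod_cast h1
  have h2' : -1 < n := by exact_mod_cast h2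
  have : n = 0 := by omega
  simpa [this] using hzw

theorem exists_zero_on_line {k : ℕ} {lam : ℕ → ℝ} (hl : HeckeMult lam) (hk : 32 ≤ k)
    {j : ℕ} (hjk : j + 2 ≤ k)
    (hsize : 60 * ((j : ℝ) + 2) ^ 2 * Real.log k ≤ ((k : ℝ) - 1) / 2)
    (hlow : ∀ i ≤ j + 1, (k : ℝ)⁻¹ ≤ |lam (i + 1)|) {x σ : ℝ}
    (hx : Complex.exp (2 * Real.pi * Complex.I * x) = σ)
    (hσ : lam (j + 1) * lam (j + 2) * σ < 0) :
    ∃ z : ℂ, fk k lam z = 0 ∧ z.re = x ∧ ((k : ℝ) - 1) / 2 / (j + 2) < 2 * Real.pi * z.im ∧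
      2 * Real.pi * z.im ≤ ((k : ℝ) - 1) / 2 / (j + 1) := by
  have hk' : (32 : ℝ) ≤ k := by exact_mod_cast hk
  have hlog : 0 ≤ Real.log k := Real.log_nonneg (by linarith)
  have hsize' : 60 * ((j : ℝ) + 1) ^ 2 * Real.log k ≤ ((k : ℝ) - 1) / 2 := by
    refine le_trans ?_ hsize
    gcongr
    norm_num
  have hj2 : (((j + 1 : ℕ) : ℝ) + 1) = (j : ℝ) + 2 := by push_cast; ring
  have hpi := Real.pi_pos
  have hκ : 0 < ((k : ℝ) - 1) / 2 := by linarith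
  set κ : ℝ := ((k : ℝ) - 1) / 2 with hκ_def
  set y₀ : ℝ := κ / (j + 2) / (2 * Real.pi) with hy₀
  set y₁ : ℝ := κ / (j + 1) / (2 * Real.pi) with hy₁
  have hy₀pos : 0 < y₀ := by positivity
  have hy₁pos : 0 < y₁ := by positivity
  have hy₀t : 2 * Real.pi * y₀ = κ / (j + 2) := by rw [hy₀]; field_simp
  have hy₁t : 2 * Real.pi * y₁ = κ / (j + 1) := by rw [hy₁]; field_simp
  have hyy : y₀ ≤ y₁ := by
    rw [hy₀, hy₁]
    gcongr
    norm_num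
  have him : ∀ y : ℝ, ((x : ℂ) + y * Complex.I).im = y := fun y => by simp
  have hexp : ∀ y : ℝ, Complex.exp (2 * Real.pi * Complex.I * ((x : ℂ) + y * Complex.I)) =
      ((σ * Real.exp (-(2 * Real.pi * y)) : ℝ) : ℂ) := fun y => by
    rw [mul_add, Complex.exp_add, hx]
    push_cast
    congr 2
    linear_combination (2 * Real.pi * y : ℂ) * Complex.I_mul_I
  set g : ℝ → ℝ := fun y => (fk k lam ((x : ℂ) + y * Complex.I)).re with hg
  have hcont : ContinuousOn g (Set.Icc y₀ y₁) := fun y hy => by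
    have hy0 : 0 < ((x : ℂ) + y * Complex.I).im := by rw [him]; exact hy₀pos.trans_le hy.1
    have h1 : ContinuousAt (fun y : ℝ => fk k lam ((x : ℂ) + y * Complex.I)) y :=
      ContinuousAt.comp (f := fun y : ℝ => (x : ℂ) + y * Complex.I) (continuousAt_fk hl hy0)
        (by fun_prop)
    exact (Complex.continuous_re.continuousAt.comp h1).continuousWithinAt
  have h₀ : 0 < lam (j + 2) * (σ * Real.exp (-(2 * Real.pi * y₀))) ^ (j + 2) * g y₀ :=
    mul_fk_re_pos (j := j + 1) hl hk hjk (by rw [hj2]; exact hsize) (hlow _ le_rfl)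
      (by rw [him]; exact hy₀pos) (by rw [him, hy₀t, hj2]) (hexp y₀)
  have h₁ : 0 < lam (j + 1) * (σ * Real.exp (-(2 * Real.pi * y₁))) ^ (j + 1) * g y₁ :=
    mul_fk_re_pos hl hk (by omega) hsize' (hlow j (by omega))
      (by rw [him]; exact hy₁pos) (by rw [him, hy₁t]) (hexp y₁)
  have hsign : g y₀ * g y₁ < 0 := by
    have hprod := mul_pos h₀ h₁
    have hE : 0 < Real.exp (-(2 * Real.pi * y₀)) ^ (j + 2) *
      Real.exp (-(2 * Real.pi * y₁)) ^ (j + 1) * (σ ^ 2) ^ (j + 1) := by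
      have : σ ≠ 0 := by rintro rfl; simp at hσ
      positivity
    have e : lam (j + 2) * (σ * Real.exp (-(2 * Real.pi * y₀))) ^ (j + 2) * g y₀ *
        (lam (j + 1) * (σ * Real.exp (-(2 * Real.pi * y₁))) ^ (j + 1) * g y₁) =
        (lam (j + 1) * lam (j + 2) * σ) * (Real.exp (-(2 * Real.pi * y₀)) ^ (j + 2) *
          Real.exp (-(2 * Real.pi * y₁)) ^ (j + 1) * (σ ^ 2) ^ (j + 1)) * (g y₀ * g y₁) := by
      ring
    rw [e] at hprod
    exact neg_of_mul_pos_right hprod (mul_neg_of_neg_of_pos hσ hE).le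
  obtain ⟨y, hy, hgy⟩ : ∃ y ∈ Set.Icc y₀ y₁, g y = 0 := by
    rcases mul_neg_iff.1 hsign with ⟨ha, hb⟩ | ⟨ha, hb⟩
    · exact intermediate_value_Icc' hyy hcont ⟨hb.le, ha.le⟩
    · exact intermediate_value_Icc hyy hcont ⟨ha.le, hb.le⟩
  have hne : y₀ ≠ y := by
    rintro rfl
    simp [hgy] at hsign
  have hlt : y₀ < y := lt_of_le_of_ne hy.1 hne
  refine ⟨x + y * Complex.I, ?_, by simp, ?_, ?_⟩
  · exact Complex.ext hgy (fk_im_eq_zero hl (by rw [him]; linarith) (hexp y))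
  · rw [him, ← hy₀t]; gcongr
  · rw [him, ← hy₁t]; gcongr; exact hy.2

/-- Between two consecutive vertices `f_k` has exactly one zero modulo translation; it is simple
and lies on one of the two lines of symmetry. -/
theorem exists_unique_simple_zero {k : ℕ} {lam : ℕ → ℝ} (hl : HeckeMult lam) (hk : 32 ≤ k)
    {j : ℕ} (hjk : j + 2 ≤ k)
    (hsize : 60 * ((j : ℝ) + 2) ^ 2 * Real.log k ≤ ((k : ℝ) - 1) / 2)
    (hlow : ∀ i ≤ j + 1, (k : ℝ)⁻¹ ≤ |lam (i + 1)|) :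
    ∃ z : ℂ,
      (fk k lam z = 0 ∧ -(1 / 2) < z.re ∧ z.re ≤ 1 / 2 ∧
        ((k : ℝ) - 1) / 2 / (j + 2) < 2 * Real.pi * z.im ∧
        2 * Real.pi * z.im ≤ ((k : ℝ) - 1) / 2 / (j + 1)) ∧
      (∀ w : ℂ, (fk k lam w = 0 ∧ -(1 / 2) < w.re ∧ w.re ≤ 1 / 2 ∧
        ((k : ℝ) - 1) / 2 / (j + 2) < 2 * Real.pi * w.im ∧
        2 * Real.pi * w.im ≤ ((k : ℝ) - 1) / 2 / (j + 1)) → w = z) ∧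
      (0 < lam (j + 1) * lam (j + 2) → z.re = 1 / 2) ∧
      (lam (j + 1) * lam (j + 2) < 0 → z.re = 0) ∧ deriv (fk k lam) z ≠ 0 := by
  have hk' : (32 : ℝ) ≤ k := by exact_mod_cast hk
  have hne1 : lam (j + 1) ≠ 0 := ne_zero_of_inv_le_abs (by omega) (hlow j (by omega))
  have hne2 : lam (j + 2) ≠ 0 := ne_zero_of_inv_le_abs (by omega) (hlow (j + 1) le_rfl)
  have hc : heckeCoeff k lam (j + 1) ≠ 0 := heckeCoeff_ne_zero hne2
  have hpi := Real.pi_pos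
  have hκ : 0 < ((k : ℝ) - 1) / 2 / ((j : ℝ) + 2) := by
    have : 0 < (k : ℝ) - 1 := by linarith
    positivity
  have hpos : ∀ w : ℂ, ((k : ℝ) - 1) / 2 / (j + 2) < 2 * Real.pi * w.im → 0 < w.im :=
    fun w hw => pos_of_mul_pos_right (hκ.trans hw) (by positivity)
  have hdom : ∀ w : ℂ, ((k : ℝ) - 1) / 2 / (j + 2) < 2 * Real.pi * w.im →
      2 * Real.pi * w.im ≤ ((k : ℝ) - 1) / 2 / (j + 1) →
      TwoTermDominated (heckeCoeff k lam) j ‖Complex.exp (2 * Real.pi * Complex.I * w)‖ :=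
    fun w hw hw' => by
      rw [norm_exp_two_pi_I_mul]
      exact twoTermDominated_heckeCoeff hl hk hjk hsize hlow hw.le hw'
  obtain ⟨z, hz0, hzl, hzr, hz1, hz2, hzp, hzn⟩ : ∃ z : ℂ, fk k lam z = 0 ∧ -(1 / 2) < z.re ∧
      z.re ≤ 1 / 2 ∧ ((k : ℝ) - 1) / 2 / (j + 2) < 2 * Real.pi * z.im ∧
      2 * Real.pi * z.im ≤ ((k : ℝ) - 1) / 2 / (j + 1) ∧
      (0 < lam (j + 1) * lam (j + 2) → z.re = 1 / 2) ∧
      (lam (j + 1) * lam (j + 2) < 0 → z.re = 0) := by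
    rcases lt_or_gt_of_ne (mul_ne_zero hne1 hne2) with h | h
    · obtain ⟨z, h0, hre, h1, h2⟩ := exists_zero_on_line hl hk hjk hsize hlow (x := 0) (σ := 1)
        (by simp) (by linarith)
      exact ⟨z, h0, by rw [hre]; norm_num, by rw [hre]; norm_num, h1, h2,
        fun h' => absurd h' h.not_gt, fun _ => hre⟩
    · obtain ⟨z, h0, hre, h1, h2⟩ := exists_zero_on_line hl hk hjk hsize hlow (x := 1 / 2)
        (σ := -1) (by
          rw [show (2 * Real.pi * Complex.I * ((1 / 2 : ℝ) : ℂ)) = Real.pi * Complex.I by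
            push_cast; ring, Complex.exp_pi_mul_I]
          simp) (by linarith)
      exact ⟨z, h0, by rw [hre]; norm_num, by rw [hre], h1, h2, fun _ => hre,
        fun h' => absurd h' h.not_gt⟩
  have hsum : ∀ w : ℂ, fk k lam w = 0 → 0 < w.im →
      HasSum (fun n => (heckeCoeff k lam n : ℂ) *
        Complex.exp (2 * Real.pi * Complex.I * w) ^ (n + 1)) 0 :=
    fun w hw hw' => hw ▸ hasSum_fk hl hw'
  refine ⟨z, ⟨hz0, hzl, hzr, hz1, hz2⟩, ?_, hzp, hzn, ?_⟩
  · rintro w ⟨hw0, hwl, hwr, hw1, hw2⟩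
    exact eq_of_exp_eq_of_re_mem hwl hwr hzl hzr
      (TwoTermDominated.eq_of_hasSum_zero (Complex.exp_ne_zero _) (Complex.exp_ne_zero _) hc
        (hdom w hw1 hw2) (hdom z hz1 hz2) (hsum w hw0 (hpos w hw1)) (hsum z hz0 (hpos z hz1)))
  · have hd := (hasSum_deriv_fk (k := k) hl (hpos z hz1)).mul_left
      (2 * Real.pi * Complex.I : ℂ)⁻¹
    simp only [inv_mul_cancel_left₀ Complex.two_pi_I_ne_zero] at hd
    exact right_ne_zero_of_mul ((hdom z hz1 hz2).hasSum_deriv_ne_zero (Complex.exp_ne_zero _) hc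
      (hsum z hz0 (hpos z hz1)) hd)

/-- For every sufficiently small `δ > 0` there are `β₁ ≥ 1`, `A > 0` and `K` such that
for every even `k ≥ K`, every Hecke-multiplicative `λ` and every integer `L` with
`β₁ ≤ L < δ √(k/log k)` such that `|λ(l)| ≥ k^(-δ/2)` for all `1 ≤ l ≤ L`:
every zero `z` of `f_k` with `-1/2 < Re z ≤ 1/2` and `Im z ≥ A k/L` has `Re z = 0` or
`Re z = 1/2` and is simple; and for every `β₁ ≤ l ≤ L - 1` there is exactly one zero `z`
of `f_k` with `-1/2 < Re z ≤ 1/2` and `(k-1)/(4π(l+1)) < Im z ≤ (k-1)/(4πl)`, and this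
zero has `Re z = 1/2` if `λ(l)λ(l+1) > 0` and `Re z = 0` if `λ(l)λ(l+1) < 0`. -/
theorem stmt_17 :
    ∃ δ₀ : ℝ, 0 < δ₀ ∧ ∀ δ : ℝ, 0 < δ → δ ≤ δ₀ →
      ∃ β₁ A K : ℝ, 1 ≤ β₁ ∧ 0 < A ∧
        ∀ k : ℕ, Even k → K ≤ (k : ℝ) →
          ∀ lam : ℕ → ℝ, HeckeMult lam →
            ∀ L : ℕ, β₁ ≤ (L : ℝ) → (L : ℝ) < δ * Real.sqrt ((k : ℝ) / Real.log k) →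
              (∀ l : ℕ, 1 ≤ l → l ≤ L → (k : ℝ) ^ (-δ / 2) ≤ |lam l|) →
              (∀ z : ℂ, -(1 / 2) < z.re → z.re ≤ 1 / 2 → A * k / L ≤ z.im →
                  fk k lam z = 0 →
                (z.re = 0 ∨ z.re = 1 / 2) ∧ deriv (fk k lam) z ≠ 0) ∧
              (∀ l : ℕ, β₁ ≤ (l : ℝ) → l ≤ L - 1 →
                ∃ z : ℂ,
                  (fk k lam z = 0 ∧ -(1 / 2) < z.re ∧ z.re ≤ 1 / 2 ∧
                    ((k : ℝ) - 1) / (4 * Real.pi * (l + 1)) < z.im ∧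
                    z.im ≤ ((k : ℝ) - 1) / (4 * Real.pi * l)) ∧
                  (∀ w : ℂ,
                    (fk k lam w = 0 ∧ -(1 / 2) < w.re ∧ w.re ≤ 1 / 2 ∧
                      ((k : ℝ) - 1) / (4 * Real.pi * (l + 1)) < w.im ∧
                      w.im ≤ ((k : ℝ) - 1) / (4 * Real.pi * l)) → w = z) ∧
                  (0 < lam l * lam (l + 1) → z.re = 1 / 2) ∧
                  (lam l * lam (l + 1) < 0 → z.re = 0)) := by
  refine ⟨1 / 16, by norm_num, fun δ hδ hδ' => ⟨1, 1, 32, le_rfl, one_pos, ?_⟩⟩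
  intro k _ hK lam hl L hL1 hL hlow'
  have hk : 32 ≤ k := by exact_mod_cast hK
  have hk0 : (0 : ℝ) < k := by linarith
  have hpi := Real.pi_pos
  have hL0 : (0 : ℝ) < L := by linarith
  have hlog : 1 ≤ Real.log k := by
    rw [Real.le_log_iff_exp_le hk0]
    linarith [Real.exp_one_lt_d9]
  have hLsq : (L : ℝ) ^ 2 * Real.log k ≤ k / 256 := by
    have h1 : (L : ℝ) ^ 2 ≤ (1 / 16) ^ 2 * (k / Real.log k) := by
      rw [← Real.sq_sqrt (by positivity : 0 ≤ (k : ℝ) / Real.log k), ← mul_pow]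
      refine pow_le_pow_left₀ hL0.le (hL.le.trans ?_) 2
      gcongr
    have h2 : (1 / 16) ^ 2 * ((k : ℝ) / Real.log k) * Real.log k = k / 256 := by
      field_simp
      norm_num
    rw [← h2]
    gcongr
  have hLk : L ≤ k := by
    have : (L : ℝ) ≤ k := by nlinarith [mul_nonneg (sq_nonneg (L : ℝ)) (sub_nonneg.2 hlog)]
    exact_mod_cast this
  have hsize : ∀ x : ℝ, 0 ≤ x → x ≤ L → 60 * x ^ 2 * Real.log k ≤ ((k : ℝ) - 1) / 2 := by
    intro x hx hxL
    have : x ^ 2 * Real.log k ≤ (L : ℝ) ^ 2 * Real.log k := by gcongr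
    linarith
  have hlow : ∀ i, i + 1 ≤ L → (k : ℝ)⁻¹ ≤ |lam (i + 1)| := fun i hi => by
    refine le_trans ?_ (hlow' (i + 1) (by omega) hi)
    rw [← Real.rpow_neg_one]
    exact Real.rpow_le_rpow_of_exponent_le (by linarith) (by linarith)
  have hband : ∀ j, j + 2 ≤ L → _ := fun j hj =>
    exists_unique_simple_zero hl hk (j := j) (by omega)
      (hsize _ (by positivity) (by exact_mod_cast hj)) (fun i hi => hlow i (by omega))
  have hlower : ∀ j y : ℝ, 0 ≤ j → (((k : ℝ) - 1) / (4 * Real.pi * (j + 1)) < y ↔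
      ((k : ℝ) - 1) / 2 / (j + 1) < 2 * Real.pi * y) := fun j y hj => by
    rw [div_lt_iff₀ (by positivity), div_lt_iff₀ (by positivity)]
    constructor <;> intro h <;> linarith
  have hupper : ∀ j y : ℝ, 0 < j → (y ≤ ((k : ℝ) - 1) / (4 * Real.pi * j) ↔
      2 * Real.pi * y ≤ ((k : ℝ) - 1) / 2 / j) := fun j y hj => by
    rw [le_div_iff₀ (by positivity), le_div_iff₀ (by positivity)]
    constructor <;> intro h <;> linarith
  constructor
  · intro z hzl hzr hzim hz0
    have hy : 0 < z.im := lt_of_lt_of_le (by positivity) hzim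
    have ht : 0 < 2 * Real.pi * z.im := by positivity
    by_cases htop : ((k : ℝ) - 1) / 2 ≤ 2 * Real.pi * z.im
    · refine absurd hz0 (fk_ne_zero_of_le_im hl hk ?_ hy htop)
      simpa using hsize 1 zero_le_one hL1
    · push Not at htop
      have hκ : 0 < ((k : ℝ) - 1) / 2 := by linarith
      have hq0 : 0 ≤ ((k : ℝ) - 1) / 2 / (2 * Real.pi * z.im) := by positivity
      have hfl := Nat.floor_le hq0
      have hfl' := Nat.lt_floor_add_one (((k : ℝ) - 1) / 2 / (2 * Real.pi * z.im))
      have hl1 : 1 ≤ ⌊((k : ℝ) - 1) / 2 / (2 * Real.pi * z.im)⌋₊ := by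
        rw [Nat.one_le_floor_iff, one_le_div ht]
        exact htop.le
      obtain ⟨j, hj⟩ := Nat.exists_eq_add_of_le' hl1
      rw [hj] at hfl hfl'
      rw [le_div_iff₀ ht] at hfl
      rw [div_lt_iff₀ ht] at hfl'
      push_cast at hfl hfl'
      have hz1 : ((k : ℝ) - 1) / 2 / (j + 2) < 2 * Real.pi * z.im := by
        rw [div_lt_iff₀ (by positivity)]
        linarith
      have hz2 : 2 * Real.pi * z.im ≤ ((k : ℝ) - 1) / 2 / (j + 1) := by
        rw [le_div_iff₀ (by positivity)]
        linarith
      have hjL : j + 2 ≤ L := by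
        rw [one_mul, div_le_iff₀ hL0] at hzim
        have h2 : ((j : ℝ) + 1) * (6 * z.im) ≤ k / 2 := by
          have : 6 * z.im ≤ 2 * Real.pi * z.im := by nlinarith [Real.pi_gt_three]
          nlinarith [(Nat.cast_nonneg j : (0 : ℝ) ≤ j)]
        have h3 : 12 * ((j : ℝ) + 1) ≤ L := by
          refine le_of_mul_le_mul_right ?_ hy
          linarith
        have h4 : (j : ℝ) + 2 ≤ L := by linarith [(Nat.cast_nonneg j : (0 : ℝ) ≤ j)]
        exact_mod_cast h4
      obtain ⟨z', -, huniq, hp, hn, hd⟩ := hband j hjL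
      obtain rfl := huniq z ⟨hz0, hzl, hzr, hz1, hz2⟩
      refine ⟨?_, hd⟩
      have hne : lam (j + 1) * lam (j + 2) ≠ 0 :=
        mul_ne_zero (ne_zero_of_inv_le_abs (by omega) (hlow j (by omega)))
          (ne_zero_of_inv_le_abs (by omega) (hlow (j + 1) (by omega)))
      rcases lt_or_gt_of_ne hne with h | h
      · exact Or.inl (hn h)
      · exact Or.inr (hp h)
  · intro l hl1 hlL
    have hl1' : 1 ≤ l := by exact_mod_cast hl1
    obtain ⟨j, rfl⟩ := Nat.exists_eq_add_of_le' hl1'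
    obtain ⟨z, hz, huniq, hp, hn, -⟩ := hband j (by omega)
    have e1 : (((j + 1 : ℕ) : ℝ) + 1) = (j : ℝ) + 2 := by push_cast; ring
    have e2 : ((j + 1 : ℕ) : ℝ) = (j : ℝ) + 1 := by push_cast; ring
    refine ⟨z, ?_, ?_, hp, hn⟩
    · rw [hlower _ _ (by positivity), hupper _ _ (by positivity), e1, e2]
      exact hz
    · intro w hw
      rw [hlower _ _ (by positivity), hupper _ _ (by positivity), e1, e2] at hw
      exact huniq w hw
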